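/- Let Δ be a reduced crystallographic root system spanning a finite-dimensional real inner product space V, with Weyl group W, base Π = {α_1, …, α_l}, positive system Δ⁺, and simple reflections s_i := s_{α_i}. Let μ : Δ → ℝ be W-invariant and set ρ_μ := (1/2) Σ_{α ∈ Δ⁺} μ(α) α. Let w = s_{i_1} s_{i_2} ⋯ s_{i_ℓ} be a reduced expression of w ∈ W and for 1 ≤ n ≤ ℓ set α^n := s_{i_1} ⋯ s_{i_{n−1}}(α_{i_n}). Then for every 1 ≤ n ≤ ℓ, the vector η_n := −ρ_μ + Σ_{m=1}^{n−1} μ(α^m) α^m + (1/2) μ(α^n) α^n is orthogonal to the coroot (α^n)^∨; equivalently, ⟨ρ_μ, (α^n)^∨⟩ = μ(α^n) + Σ_{m=1}^{n−1} μ(α^m) ⟨α^m, (α^n)^∨⟩. -/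

import Mathlib

open scoped RealInnerProductSpace BigOperators

variable {V : Type*} [NormedAddCommGroup V] [InnerProductSpace ℝ V]

/-- The orthogonal reflection `s_α : x ↦ x − (2 (x|α)/(α|α)) α` in the hyperplane
orthogonal to `α`, as a linear automorphism of `V`. -/
noncomputable def rootReflection (α : V) : V ≃ₗ[ℝ] V where
  toFun x := x - (2 * ⟪x, α⟫ / ⟪α, α⟫) • α
  invFun x := x - (2 * ⟪x, α⟫ / ⟪α, α⟫) • α
  map_add' x y := by
    simp only [inner_add_left]
    rw [show 2 * (⟪x, α⟫ + ⟪y, α⟫) / ⟪α, α⟫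
        = 2 * ⟪x, α⟫ / ⟪α, α⟫ + 2 * ⟪y, α⟫ / ⟪α, α⟫ by ring, add_smul]
    abel
  map_smul' c x := by
    simp only [real_inner_smul_left, RingHom.id_apply, smul_sub, smul_smul]
    rw [show 2 * (c * ⟪x, α⟫) / ⟪α, α⟫ = c * (2 * ⟪x, α⟫ / ⟪α, α⟫) by ring]
  left_inv x := by
    rcases eq_or_ne α 0 with h | h
    · simp [h]
    · have hα : ⟪α, α⟫ ≠ 0 := inner_self_ne_zero.mpr h
      simp only [inner_sub_left, real_inner_smul_left]
      rw [show 2 * (⟪x, α⟫ - 2 * ⟪x, α⟫ / ⟪α, α⟫ * ⟪α, α⟫) / ⟪α, α⟫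
          = -(2 * ⟪x, α⟫ / ⟪α, α⟫) by field_simp; ring]
      module
  right_inv x := by
    rcases eq_or_ne α 0 with h | h
    · simp [h]
    · have hα : ⟪α, α⟫ ≠ 0 := inner_self_ne_zero.mpr h
      simp only [inner_sub_left, real_inner_smul_left]
      rw [show 2 * (⟪x, α⟫ - 2 * ⟪x, α⟫ / ⟪α, α⟫ * ⟪α, α⟫) / ⟪α, α⟫
          = -(2 * ⟪x, α⟫ / ⟪α, α⟫) by field_simp; ring]
      module

/-- `Δ` is a reduced crystallographic root system in the real inner product space `V`. -/
structure IsRootSystem {V : Type*} [NormedAddCommGroup V] [InnerProductSpace ℝ V]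
    (Δ : Finset V) : Prop where
  /-- `0 ∉ Δ`. -/
  ne_zero : ∀ α ∈ Δ, α ≠ 0
  /-- `Δ` spans `V`. -/
  span_eq_top : Submodule.span ℝ (Δ : Set V) = ⊤
  /-- each reflection `s_α` maps `Δ` onto itself. -/
  reflect_mem : ∀ α ∈ Δ, ∀ β ∈ Δ, β - (2 * ⟪β, α⟫ / ⟪α, α⟫) • α ∈ Δ
  /-- crystallographic condition: `2(α|β)/(β|β) ∈ ℤ`. -/
  crystallographic : ∀ α ∈ Δ, ∀ β ∈ Δ, ∃ n : ℤ, 2 * ⟪α, β⟫ / ⟪β, β⟫ = (n : ℝ)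
  /-- reduced: `ℝα ∩ Δ = {α, −α}`. -/
  reduced : ∀ α ∈ Δ, ∀ t : ℝ, t • α ∈ Δ → t = 1 ∨ t = -1

/-- The Weyl group of `Δ`: the group of (orthogonal) transformations of `V` generated by
the reflections `s_α`, `α ∈ Δ`. -/
noncomputable def weylGroup (Δ : Finset V) : Subgroup (V ≃ₗ[ℝ] V) :=
  Subgroup.closure {g | ∃ α ∈ Δ, g = rootReflection α}

/-- `Δ` is irreducible: the only subspaces of `V` invariant under the Weyl group
are `{0}` and `V`. -/
def IsIrreducibleRS (Δ : Finset V) : Prop :=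
  ∀ U : Submodule ℝ V, (∀ w ∈ weylGroup Δ, ∀ x ∈ U, w x ∈ U) → U = ⊥ ∨ U = ⊤

/-- `b` is a base of `Δ`: a basis of `V` consisting of roots such that every root is an
integer combination of the base with coefficients all nonnegative or all nonpositive. -/
structure IsBase {V : Type*} [NormedAddCommGroup V] [InnerProductSpace ℝ V]
    (Δ : Finset V) {ι : Type*} [Fintype ι] (b : Module.Basis ι ℝ V) : Prop where
  mem : ∀ i, b i ∈ Δ
  int_coeff : ∀ α ∈ Δ, ∀ i, ∃ n : ℤ, b.repr α i = (n : ℝ)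
  same_sign : ∀ α ∈ Δ, (∀ i, 0 ≤ b.repr α i) ∨ (∀ i, b.repr α i ≤ 0)

open Classical in
/-- The set `Δ⁺` of positive roots with respect to the base `b`. -/
noncomputable def posRoots (Δ : Finset V) {ι : Type*} [Fintype ι] (b : Module.Basis ι ℝ V) :
    Finset V :=
  Δ.filter fun α => ∀ i, 0 ≤ b.repr α i

/-- The product `s_{i₁} ∘ s_{i₂} ∘ ⋯ ∘ s_{i_m}` of the reflections in the simple roots
`b (j 0), …, b (j (m-1))`. -/
noncomputable def simpleReflProd {V : Type*} [NormedAddCommGroup V]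
    [InnerProductSpace ℝ V] {ι : Type*} (b : Module.Basis ι ℝ V) {m : ℕ} (j : Fin m → ι) :
    V ≃ₗ[ℝ] V :=
  (List.ofFn fun k : Fin m => rootReflection (b (j k))).prod

/-- The root `α^n := s_{i₁} ⋯ s_{i_{n-1}} (α_{i_n})` attached to the `n`-th letter of the
word `s_{i₁} ⋯ s_{i_ℓ}` (here `n : Fin ℓ` is `0`-indexed). -/
noncomputable def chainRoot {V : Type*} [NormedAddCommGroup V]
    [InnerProductSpace ℝ V] {ι : Type*} (b : Module.Basis ι ℝ V) {l : ℕ} (idx : Fin l → ι)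
    (n : Fin l) : V :=
  simpleReflProd b (fun m : Fin (n : ℕ) => idx ⟨m, m.isLt.trans n.isLt⟩) (b (idx n))

theorem rootReflection_apply (α x : V) :
    rootReflection α x = x - (2 * ⟪x, α⟫ / ⟪α, α⟫) • α := rfl

theorem rootReflection_self {α : V} (hα : α ≠ 0) : rootReflection α α = -α := by
  have h : ⟪α, α⟫ ≠ 0 := inner_self_ne_zero.mpr hα
  rw [rootReflection_apply, mul_div_assoc, div_self h]
  module

theorem rootReflection_rootReflection (α x : V) :
    rootReflection α (rootReflection α x) = x :=
  (rootReflection α).left_inv x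

theorem inner_rootReflection_rootReflection (α x y : V) :
    ⟪rootReflection α x, rootReflection α y⟫ = ⟪x, y⟫ := by
  rcases eq_or_ne α 0 with h | h
  · simp [rootReflection_apply, h]
  · have hα : ⟪α, α⟫ ≠ 0 := inner_self_ne_zero.mpr h
    simp only [rootReflection_apply, inner_sub_left, inner_sub_right, real_inner_smul_left,
      real_inner_smul_right, real_inner_comm y α]
    field_simp
    ring

theorem simpleReflProd_succ {ι : Type*} (b : Module.Basis ι ℝ V) {m : ℕ}
    (j : Fin (m + 1) → ι) :
    simpleReflProd b j =
      simpleReflProd b (fun k : Fin m => j k.castSucc) *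
        rootReflection (b (j (Fin.last m))) := by
  rw [simpleReflProd, List.ofFn_succ', List.concat_eq_append, List.prod_append,
    List.prod_singleton, simpleReflProd]

theorem inner_simpleReflProd_simpleReflProd {ι : Type*} (b : Module.Basis ι ℝ V) {m : ℕ}
    (j : Fin m → ι) (x y : V) :
    ⟪simpleReflProd b j x, simpleReflProd b j y⟫ = ⟪x, y⟫ := by
  induction m generalizing x y with
  | zero => simp [simpleReflProd]
  | succ m ih =>
    rw [simpleReflProd_succ, LinearEquiv.mul_apply, LinearEquiv.mul_apply, ih,
      inner_rootReflection_rootReflection]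

theorem rootReflection_mem_weylGroup {Δ : Finset V} {α : V} (hα : α ∈ Δ) :
    rootReflection α ∈ weylGroup Δ :=
  Subgroup.subset_closure ⟨α, hα, rfl⟩

theorem simpleReflProd_mem_weylGroup {ι : Type*} [Fintype ι] {Δ : Finset V}
    {b : Module.Basis ι ℝ V} (hb : IsBase Δ b) {m : ℕ} (j : Fin m → ι) :
    simpleReflProd b j ∈ weylGroup Δ := by
  refine Subgroup.list_prod_mem _ fun g hg => ?_
  obtain ⟨k, rfl⟩ := List.mem_ofFn.mp hg
  exact rootReflection_mem_weylGroup (hb.mem _)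

theorem mem_posRoots {ι : Type*} [Fintype ι] {Δ : Finset V} {b : Module.Basis ι ℝ V} {α : V} :
    α ∈ posRoots Δ b ↔ α ∈ Δ ∧ ∀ i, 0 ≤ b.repr α i := by
  simp [posRoots]

theorem basis_mem_posRoots {ι : Type*} [Fintype ι] {Δ : Finset V} {b : Module.Basis ι ℝ V}
    (hb : IsBase Δ b) (i : ι) : b i ∈ posRoots Δ b := by
  classical
  refine mem_posRoots.mpr ⟨hb.mem i, fun k => ?_⟩
  rw [b.repr_self, Finsupp.single_apply]
  split_ifs <;> norm_num

/-- A positive root other than the simple root `b i` has a positive coefficient at some other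
simple root. -/
theorem exists_repr_pos_of_ne {ι : Type*} [Fintype ι] {Δ : Finset V} (hΔ : IsRootSystem Δ)
    {b : Module.Basis ι ℝ V} (hb : IsBase Δ b) {i : ι} {α : V} (hα : α ∈ posRoots Δ b)
    (hne : α ≠ b i) : ∃ k, k ≠ i ∧ 0 < b.repr α k := by
  classical
  obtain ⟨hmem, hpos⟩ := mem_posRoots.mp hα
  by_contra! h
  have hsmul : b.repr α i • b i = α := by
    conv_rhs => rw [← b.sum_repr α]
    symm
    refine Fintype.sum_eq_single i fun k hk => ?_
    rw [le_antisymm (h k hk) (hpos k), zero_smul]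
  rcases hΔ.reduced (b i) (hb.mem i) _ (hsmul ▸ hmem) with h1 | h1
  · rw [h1, one_smul] at hsmul
    exact hne hsmul.symm
  · linarith [hpos i]

/-- A simple reflection permutes the positive roots other than its own simple root. -/
theorem rootReflection_mem_posRoots_erase [DecidableEq V] {ι : Type*} [Fintype ι]
    {Δ : Finset V} (hΔ : IsRootSystem Δ) {b : Module.Basis ι ℝ V} (hb : IsBase Δ b) (i : ι)
    {α : V} (hα : α ∈ (posRoots Δ b).erase (b i)) :
    rootReflection (b i) α ∈ (posRoots Δ b).erase (b i) := by
  obtain ⟨hne, hα⟩ := Finset.mem_erase.mp hα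
  obtain ⟨hmem, hpos⟩ := mem_posRoots.mp hα
  obtain ⟨k, hk, hkpos⟩ := exists_repr_pos_of_ne hΔ hb hα hne
  have hrefl : rootReflection (b i) α ∈ Δ := hΔ.reflect_mem _ (hb.mem i) _ hmem
  have hcoeff : b.repr (rootReflection (b i) α) k = b.repr α k := by
    simp [rootReflection_apply, Finsupp.single_eq_of_ne hk]
  refine Finset.mem_erase.mpr ⟨fun h => ?_, mem_posRoots.mpr ⟨hrefl, ?_⟩⟩
  · rw [h, b.repr_self, Finsupp.single_eq_of_ne hk] at hcoeff
    exact hkpos.ne hcoeff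
  · refine (hb.same_sign _ hrefl).resolve_right fun h => ?_
    linarith [h k]

theorem rootReflection_sum_posRoots {ι : Type*} [Fintype ι] {Δ : Finset V}
    (hΔ : IsRootSystem Δ) {b : Module.Basis ι ℝ V} (hb : IsBase Δ b) {μ : V → ℝ}
    (hμ : ∀ w ∈ weylGroup Δ, ∀ α ∈ Δ, μ (w α) = μ α) (i : ι) :
    rootReflection (b i) (∑ α ∈ posRoots Δ b, μ α • α) =
      (∑ α ∈ posRoots Δ b, μ α • α) - (2 * μ (b i)) • b i := by
  classical
  have hfix : ∑ α ∈ (posRoots Δ b).erase (b i), μ α • rootReflection (b i) α =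
      ∑ α ∈ (posRoots Δ b).erase (b i), μ α • α := by
    refine Finset.sum_bij' (fun α _ => rootReflection (b i) α)
      (fun α _ => rootReflection (b i) α)
      (fun α hα => rootReflection_mem_posRoots_erase hΔ hb i hα)
      (fun α hα => rootReflection_mem_posRoots_erase hΔ hb i hα)
      (fun α _ => rootReflection_rootReflection _ α)
      (fun α _ => rootReflection_rootReflection _ α) fun α hα => ?_
    rw [hμ _ (rootReflection_mem_weylGroup (hb.mem i)) α
      (mem_posRoots.mp (Finset.mem_of_mem_erase hα)).1]
  rw [← Finset.add_sum_erase _ _ (basis_mem_posRoots hb i), map_add, map_sum]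
  simp only [map_smul]
  rw [hfix, rootReflection_self (hΔ.ne_zero _ (hb.mem i))]
  module

/-- A simple reflection moves `ρ_μ` by `μ (b i) • b i`. -/
theorem rootReflection_half_sum_posRoots {ι : Type*} [Fintype ι] {Δ : Finset V}
    (hΔ : IsRootSystem Δ) {b : Module.Basis ι ℝ V} (hb : IsBase Δ b) {μ : V → ℝ}
    (hμ : ∀ w ∈ weylGroup Δ, ∀ α ∈ Δ, μ (w α) = μ α) (i : ι) :
    rootReflection (b i) ((1 / 2 : ℝ) • ∑ α ∈ posRoots Δ b, μ α • α) =
      (1 / 2 : ℝ) • (∑ α ∈ posRoots Δ b, μ α • α) - μ (b i) • b i := by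
  rw [map_smul, rootReflection_sum_posRoots hΔ hb hμ]
  module

theorem inner_half_sum_posRoots_basis {ι : Type*} [Fintype ι] {Δ : Finset V}
    (hΔ : IsRootSystem Δ) {b : Module.Basis ι ℝ V} (hb : IsBase Δ b) {μ : V → ℝ}
    (hμ : ∀ w ∈ weylGroup Δ, ∀ α ∈ Δ, μ (w α) = μ α) (i : ι) :
    2 * ⟪(1 / 2 : ℝ) • ∑ α ∈ posRoots Δ b, μ α • α, b i⟫ = μ (b i) * ⟪b i, b i⟫ := by
  have hne : b i ≠ 0 := hΔ.ne_zero _ (hb.mem i)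
  have h := rootReflection_half_sum_posRoots hΔ hb hμ i
  rw [rootReflection_apply, sub_right_inj] at h
  exact (div_eq_iff (inner_self_ne_zero.mpr hne)).mp (smul_left_injective ℝ hne h)

theorem chainRoot_last {ι : Type*} (b : Module.Basis ι ℝ V) {m : ℕ} (j : Fin (m + 1) → ι) :
    chainRoot b j (Fin.last m) =
      simpleReflProd b (fun k : Fin m => j k.castSucc) (b (j (Fin.last m))) := rfl

theorem chainRoot_castSucc {ι : Type*} (b : Module.Basis ι ℝ V) {m : ℕ}
    (j : Fin (m + 1) → ι) (k : Fin m) :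
    chainRoot b j k.castSucc = chainRoot b (fun k : Fin m => j k.castSucc) k := rfl

theorem apply_chainRoot {ι : Type*} [Fintype ι] {Δ : Finset V} {b : Module.Basis ι ℝ V}
    (hb : IsBase Δ b) {μ : V → ℝ} (hμ : ∀ w ∈ weylGroup Δ, ∀ α ∈ Δ, μ (w α) = μ α)
    {m : ℕ} (j : Fin m → ι) (k : Fin m) : μ (chainRoot b j k) = μ (b (j k)) :=
  hμ _ (simpleReflProd_mem_weylGroup hb _) _ (hb.mem _)

/-- A product of simple reflections moves `ρ_μ` by the weighted sum of its chain of roots. -/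
theorem simpleReflProd_half_sum_posRoots {ι : Type*} [Fintype ι] {Δ : Finset V}
    (hΔ : IsRootSystem Δ) {b : Module.Basis ι ℝ V} (hb : IsBase Δ b) {μ : V → ℝ}
    (hμ : ∀ w ∈ weylGroup Δ, ∀ α ∈ Δ, μ (w α) = μ α) {m : ℕ} (j : Fin m → ι) :
    simpleReflProd b j ((1 / 2 : ℝ) • ∑ α ∈ posRoots Δ b, μ α • α) =
      (1 / 2 : ℝ) • (∑ α ∈ posRoots Δ b, μ α • α) -
        ∑ k, μ (chainRoot b j k) • chainRoot b j k := by
  induction m with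
  | zero => simp [simpleReflProd]
  | succ m ih =>
    rw [simpleReflProd_succ, LinearEquiv.mul_apply, rootReflection_half_sum_posRoots hΔ hb hμ,
      map_sub, ih, Fin.sum_univ_castSucc, apply_chainRoot hb hμ j (Fin.last m), chainRoot_last,
      map_smul, sub_sub]
    simp only [chainRoot_castSucc]

/-- Let `w = s_{i₁} ⋯ s_{i_ℓ}` be a reduced expression in the simple reflections of a
reduced crystallographic root system with base `b`, let `μ` be Weyl-invariant, and put
`ρ_μ = (1/2) Σ_{α ∈ Δ⁺} μ(α) α` and `α^n = s_{i₁} ⋯ s_{i_{n-1}}(α_{i_n})`.  Then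
`η_n := −ρ_μ + Σ_{m<n} μ(α^m) α^m + (1/2) μ(α^n) α^n` is orthogonal to the coroot
`(α^n)^∨ = (2/(α^n|α^n)) α^n`; equivalently,
`⟨ρ_μ, (α^n)^∨⟩ = μ(α^n) + Σ_{m<n} μ(α^m) ⟨α^m, (α^n)^∨⟩`. -/
theorem eta_orthogonal_chainRoot {V : Type*} [NormedAddCommGroup V]
    [InnerProductSpace ℝ V] [FiniteDimensional ℝ V] {ι : Type*} [Fintype ι]
    (Δ : Finset V) (hΔ : IsRootSystem Δ) (b : Module.Basis ι ℝ V) (hb : IsBase Δ b)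
    (μ : V → ℝ) (hμ : ∀ w ∈ weylGroup Δ, ∀ α ∈ Δ, μ (w α) = μ α)
    (l : ℕ) (idx : Fin l → ι) (w : V ≃ₗ[ℝ] V) (hw : w = simpleReflProd b idx)
    (hred : ∀ m : ℕ, ∀ j : Fin m → ι, simpleReflProd b j = w → l ≤ m) :
    ∀ n : Fin l,
      (⟪-((1 / 2 : ℝ) • ∑ α ∈ posRoots Δ b, μ α • α)
          + (∑ m : Fin (n : ℕ), μ (chainRoot b idx ⟨m, m.isLt.trans n.isLt⟩) •
              chainRoot b idx ⟨m, m.isLt.trans n.isLt⟩)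
          + ((1 / 2 : ℝ) * μ (chainRoot b idx n)) • chainRoot b idx n,
        (2 / ⟪chainRoot b idx n, chainRoot b idx n⟫) • chainRoot b idx n⟫ = 0) ∧
      (2 * ⟪(1 / 2 : ℝ) • ∑ α ∈ posRoots Δ b, μ α • α, chainRoot b idx n⟫
            / ⟪chainRoot b idx n, chainRoot b idx n⟫
        = μ (chainRoot b idx n)
          + ∑ m : Fin (n : ℕ), μ (chainRoot b idx ⟨m, m.isLt.trans n.isLt⟩)
              * (2 * ⟪chainRoot b idx ⟨m, m.isLt.trans n.isLt⟩, chainRoot b idx n⟫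
                  / ⟪chainRoot b idx n, chainRoot b idx n⟫)) := by
  intro n
  set ρ : V := (1 / 2 : ℝ) • ∑ α ∈ posRoots Δ b, μ α • α with hρ
  set u := simpleReflProd b (fun m : Fin (n : ℕ) => idx ⟨m, m.isLt.trans n.isLt⟩) with hu
  set S := ∑ m : Fin (n : ℕ), μ (chainRoot b idx ⟨m, m.isLt.trans n.isLt⟩) •
    chainRoot b idx ⟨m, m.isLt.trans n.isLt⟩ with hS
  have hsub : u ρ = ρ - S := simpleReflProd_half_sum_posRoots hΔ hb hμ _
  have hα : chainRoot b idx n = u (b (idx n)) := rfl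
  have hnorm : ⟪chainRoot b idx n, chainRoot b idx n⟫ = ⟪b (idx n), b (idx n)⟫ :=
    inner_simpleReflProd_simpleReflProd b _ _ _
  have hne : ⟪chainRoot b idx n, chainRoot b idx n⟫ ≠ 0 := by
    rw [hnorm]
    exact inner_self_ne_zero.mpr (hΔ.ne_zero _ (hb.mem _))
  have key : 2 * (⟪ρ, chainRoot b idx n⟫ - ⟪S, chainRoot b idx n⟫) =
      μ (chainRoot b idx n) * ⟪chainRoot b idx n, chainRoot b idx n⟫ := by
    rw [← inner_sub_left, ← hsub, hnorm, apply_chainRoot hb hμ, hα, hu,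
      inner_simpleReflProd_simpleReflProd]
    exact inner_half_sum_posRoots_basis hΔ hb hμ _
  constructor
  · rw [real_inner_smul_right, inner_add_left, inner_add_left, inner_neg_left,
      real_inner_smul_left (chainRoot b idx n)]
    refine mul_eq_zero_of_right _ ?_
    linarith
  · have hsum : ∑ m : Fin (n : ℕ), μ (chainRoot b idx ⟨m, m.isLt.trans n.isLt⟩)
        * (2 * ⟪chainRoot b idx ⟨m, m.isLt.trans n.isLt⟩, chainRoot b idx n⟫
          / ⟪chainRoot b idx n, chainRoot b idx n⟫) =
        2 * ⟪S, chainRoot b idx n⟫ / ⟪chainRoot b idx n, chainRoot b idx n⟫ := by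
      rw [hS, sum_inner, Finset.mul_sum, Finset.sum_div]
      refine Finset.sum_congr rfl fun m _ => ?_
      rw [real_inner_smul_left]
      ring
    rw [hsum, div_eq_iff hne, add_mul, div_mul_cancel₀ _ hne]
    linarith
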